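/- Let G be a group and G₀, G₁ subgroups of G. The Levi graph of the coset geometry (G : G₀, G₁) — the simple graph on the disjoint union (G⧸G₀) ⊕ (G⧸G₁) in which a coset xG₀ is adjacent to a coset yG₁ if and only if xG₀ ∩ yG₁ ≠ ∅ as subsets of G — is connected if and only if G₀ and G₁ together generate G, i.e. G₀ ⊔ G₁ = ⊤. -/

import Mathlib

/-- The Levi graph of the coset geometry `(G : G₀, G₁)`: the simple graph on the
disjoint union `(G ⧸ G₀) ⊕ (G ⧸ G₁)` of the left coset spaces, in which a coset
`xG₀` is adjacent to a coset `yG₁` if and only if they have nonempty intersection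
as subsets of `G` (i.e. some `g : G` lies in both), and no two vertices on the
same side are adjacent. -/
def CosetGeometry.levi (G : Type*) [Group G] (G₀ G₁ : Subgroup G) :
    SimpleGraph ((G ⧸ G₀) ⊕ (G ⧸ G₁)) where
  Adj x y :=
    match x, y with
    | Sum.inl p, Sum.inr l => ∃ g : G, (g : G ⧸ G₀) = p ∧ (g : G ⧸ G₁) = l
    | Sum.inr l, Sum.inl p => ∃ g : G, (g : G ⧸ G₀) = p ∧ (g : G ⧸ G₁) = l
    | _, _ => False
  symm := by constructor; rintro (p | l) (p' | l') h <;> exact h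
  loopless := by constructor; rintro (p | l) h <;> exact h

/-- The Levi graph of the coset geometry `(G : G₀, G₁)` is connected if and only if
the subgroups `G₀` and `G₁` together generate `G`. -/
theorem levi_connected_iff_sup_eq_top {G : Type*} [Group G] (G₀ G₁ : Subgroup G) :
    (CosetGeometry.levi G G₀ G₁).Connected ↔ G₀ ⊔ G₁ = ⊤ := by
  have hadj : ∀ g : G, (CosetGeometry.levi G G₀ G₁).Adj (Sum.inl (g : G ⧸ G₀))
      (Sum.inr (g : G ⧸ G₁)) := fun g => ⟨g, rfl, rfl⟩
  constructor
  · intro hc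
    -- the coset of `G₀ ⊔ G₁` is constant along edges
    let f : (G ⧸ G₀) ⊕ (G ⧸ G₁) → G ⧸ (G₀ ⊔ G₁) :=
      Sum.elim (Subgroup.quotientMapOfLE le_sup_left) (Subgroup.quotientMapOfLE le_sup_right)
    have hf : ∀ u v, (CosetGeometry.levi G G₀ G₁).Adj u v → f u = f v := by
      rintro (p | l) (p' | l') h
      · exact h.elim
      · obtain ⟨g, rfl, rfl⟩ := h
        rfl
      · obtain ⟨g, rfl, rfl⟩ := h
        rfl
      · exact h.elim
    have hw : ∀ u v, (CosetGeometry.levi G G₀ G₁).Walk u v → f u = f v := by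
      intro u v w
      induction w with
      | nil => rfl
      | cons h _ ih => exact (hf _ _ h).trans ih
    rw [eq_top_iff]
    intro g _
    obtain ⟨w⟩ := hc.preconnected (Sum.inl ((1 : G) : G ⧸ G₀)) (Sum.inl (g : G ⧸ G₀))
    have h : ((1 : G) : G ⧸ (G₀ ⊔ G₁)) = (g : G ⧸ (G₀ ⊔ G₁)) := hw _ _ w
    simpa using QuotientGroup.eq.1 h
  · intro htop
    let K : Subgroup G :=
      { carrier := {h | ∀ x : G, (CosetGeometry.levi G G₀ G₁).Reachable
          (Sum.inl (x : G ⧸ G₀)) (Sum.inl ((x * h : G) : G ⧸ G₀))}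
        one_mem' := fun x => by rw [mul_one]
        mul_mem' := fun {a b} ha hb x => by
          have := (ha x).trans (hb (x * a))
          rwa [mul_assoc] at this
        inv_mem' := fun {a} ha x => by
          have := (ha (x * a⁻¹)).symm
          rwa [inv_mul_cancel_right] at this }
    have h0 : G₀ ≤ K := by
      intro h hh x
      have : ((x * h : G) : G ⧸ G₀) = (x : G ⧸ G₀) := QuotientGroup.mk_mul_of_mem x hh
      rw [this]
    have h1 : G₁ ≤ K := by
      intro h hh x
      have e : ((x * h : G) : G ⧸ G₁) = (x : G ⧸ G₁) := QuotientGroup.mk_mul_of_mem x hh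
      have h2 := hadj (x * h)
      rw [e] at h2
      exact (hadj x).reachable.trans h2.symm.reachable
    have hK : ∀ g : G, g ∈ K := fun g => by
      have : g ∈ G₀ ⊔ G₁ := htop ▸ Subgroup.mem_top g
      exact sup_le h0 h1 this
    have hbase : ∀ v, (CosetGeometry.levi G G₀ G₁).Reachable
        (Sum.inl ((1 : G) : G ⧸ G₀)) v := by
      have hl : ∀ g : G, (CosetGeometry.levi G G₀ G₁).Reachable
          (Sum.inl ((1 : G) : G ⧸ G₀)) (Sum.inl (g : G ⧸ G₀)) := fun g => by
        have := hK g 1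
        rwa [one_mul] at this
      rintro (p | l)
      · induction p using QuotientGroup.induction_on with
        | H g => exact hl g
      · induction l using QuotientGroup.induction_on with
        | H g => exact (hl g).trans (hadj g).reachable
    haveI : Nonempty ((G ⧸ G₀) ⊕ (G ⧸ G₁)) := ⟨Sum.inl ((1 : G) : G ⧸ G₀)⟩
    exact ⟨fun u v => (hbase u).symm.trans (hbase v)⟩
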